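/- Let π ∈ S_NC⁺(2p,2q) (even, parity-preserving non-crossing annular permutation) be such that γ_{2p,2q}π⁻¹ separates the points of O = {1,3,…,2p+2q−1}. If k is such that 2k and π(2k) lie in the same cycle of γ_{2p,2q}, then π(2k) = γ_{2p,2q}(2k). -/

import Mathlib

open Equiv Finset
open scoped Classical

noncomputable section

def numCycles {n : ℕ} (π : Equiv.Perm (Fin n)) : ℕ :=
  π.cycleType.card + (univ.filter fun x => π x = x).card

def plen {n : ℕ} (π : Equiv.Perm (Fin n)) : ℕ := n - numCycles π

def gammaPQ (p q : ℕ) : Equiv.Perm (Fin (p + q)) :=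
  finSumFinEquiv.permCongr (Equiv.sumCongr (finRotate p) (finRotate q))

def cycleLen {n : ℕ} (π : Equiv.Perm (Fin n)) (k : Fin n) : ℕ :=
  (univ.filter fun m => π.SameCycle k m).card

def Separates {n : ℕ} (σ : Equiv.Perm (Fin n)) (A : Finset (Fin n)) : Prop :=
  ∀ a ∈ A, ∀ b ∈ A, σ.SameCycle a b → a = b

def oddSet (n : ℕ) : Finset (Fin n) := univ.filter fun i => Odd (i.val + 1)

def IsSNC (p q : ℕ) (π : Equiv.Perm (Fin (p + q))) : Prop :=
  (∃ i j, π.SameCycle i j ∧ ¬ (gammaPQ p q).SameCycle i j) ∧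
    numCycles π + numCycles (gammaPQ p q * π⁻¹) = p + q

def SameParity {n : ℕ} (a b : Fin n) : Prop := (Odd (a.val + 1) ↔ Odd (b.val + 1))

def EvenCycles {n : ℕ} (π : Equiv.Perm (Fin n)) : Prop := ∀ k, Even (cycleLen π k)

def ParityReversing {n : ℕ} (π : Equiv.Perm (Fin n)) : Prop := ∀ k, ¬ SameParity k (π k)

def SNCminus (p q : ℕ) (π : Equiv.Perm (Fin (p + q))) : Prop :=
  IsSNC p q π ∧ EvenCycles π ∧ ParityReversing π

end

/-- The setoid obtained from `r` by identifying the classes of `a` and `b`. -/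
def Setoid.merge {α : Type*} (r : Setoid α) (a b : α) : Setoid α where
  r x y := r x y ∨ ((r x a ∨ r x b) ∧ (r y a ∨ r y b))
  iseqv :=
    { refl := fun x => Or.inl (r.refl x)
      symm := by
        rintro x y (h | ⟨h, h'⟩)
        · exact Or.inl (r.symm h)
        · exact Or.inr ⟨h', h⟩
      trans := by
        rintro x y z (h | ⟨h, h'⟩) (k | ⟨k, k'⟩)
        · exact Or.inl (r.trans h k)
        · exact Or.inr ⟨k.imp (r.trans h) (r.trans h), k'⟩
        · exact Or.inr ⟨h, h'.imp (r.trans (r.symm k)) (r.trans (r.symm k))⟩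
        · exact Or.inr ⟨h, k'⟩ }

theorem Setoid.merge_le_iff {α : Type*} {r s : Setoid α} {a b : α} :
    r.merge a b ≤ s ↔ r ≤ s ∧ s a b := by
  constructor
  · intro h
    exact ⟨fun x y hxy => h (Or.inl hxy), h (Or.inr ⟨Or.inl (r.refl a), Or.inr (r.refl b)⟩)⟩
  · rintro ⟨h, hab⟩ x y (hxy | ⟨hx, hy⟩)
    · exact h hxy
    · have key : ∀ z, r z a ∨ r z b → s z a := by
        rintro z (hz | hz)
        · exact h hz
        · exact s.trans (h hz) (s.symm hab)
      exact s.trans (key x hx) (s.symm (key y hy))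

theorem Setoid.merge_eq_self {α : Type*} {r : Setoid α} {a b : α} (h : r a b) :
    r.merge a b = r :=
  le_antisymm (Setoid.merge_le_iff.2 ⟨le_rfl, h⟩) (Setoid.merge_le_iff.1 le_rfl).1

/-- The number of classes of a setoid. -/
noncomputable def Setoid.numClasses {α : Type*} (r : Setoid α) : ℕ := Nat.card (Quotient r)

theorem Setoid.numClasses_merge {α : Type*} [Finite α] {r : Setoid α} {a b : α} (h : ¬ r a b) :
    (r.merge a b).numClasses + 1 = r.numClasses := by
  have : Fintype (Quotient r) := Fintype.ofFinite _
  let f : {c : Quotient r // c ≠ Quotient.mk r b} → Quotient (r.merge a b) := fun c =>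
    Quotient.map' (s₁ := r) (s₂ := r.merge a b) id
      (fun _ _ hxy => (Setoid.merge_le_iff.1 le_rfl).1 hxy) c.1
  have hf : Function.Bijective f := by
    constructor
    · rintro ⟨c, hc⟩ ⟨d, hd⟩ hcd
      induction c using Quotient.inductionOn with | _ x
      induction d using Quotient.inductionOn with | _ y
      have hx : ¬ r x b := fun hx => hc (Quotient.sound hx)
      have hy : ¬ r y b := fun hy => hd (Quotient.sound hy)
      have hxy : r.merge a b x y := Quotient.exact hcd
      apply Subtype.ext
      apply Quotient.sound
      rcases hxy with hxy | ⟨hx', hy'⟩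
      · exact hxy
      · exact r.trans (hx'.resolve_right hx) (r.symm (hy'.resolve_right hy))
    · intro c
      induction c using Quotient.inductionOn with | _ x
      by_cases hx : r x b
      · refine ⟨⟨Quotient.mk r a, fun hab => h (Quotient.exact hab)⟩, ?_⟩
        exact Quotient.sound (s := r.merge a b) (Or.inr ⟨Or.inl (r.refl a), Or.inr hx⟩)
      · exact ⟨⟨Quotient.mk r x, fun hxb => hx (Quotient.exact hxb)⟩, rfl⟩
  have hpos : 0 < Fintype.card (Quotient r) := Fintype.card_pos_iff.2 ⟨Quotient.mk r b⟩
  rw [Setoid.numClasses, Setoid.numClasses, ← Nat.card_eq_of_bijective f hf,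
    Nat.card_eq_fintype_card, Nat.card_eq_fintype_card, Fintype.card_subtype_compl,
    Fintype.card_subtype_eq]
  omega

theorem Equiv.Perm.sameCycleSetoid_le_iff {α : Type*} [Finite α] {f : Equiv.Perm α}
    {s : Setoid α} : Equiv.Perm.SameCycle.setoid f ≤ s ↔ ∀ x, s x (f x) := by
  constructor
  · intro h x
    exact h (Equiv.Perm.sameCycle_apply_right.2 (Equiv.Perm.SameCycle.refl f x))
  · intro h x y hxy
    obtain ⟨i, rfl⟩ := hxy.exists_nat_pow_eq
    clear hxy
    induction i with
    | zero => exact s.refl x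
    | succ i ih =>
      rw [pow_succ', Equiv.Perm.mul_apply]
      exact s.trans ih (h _)

theorem Equiv.Perm.sameCycleSetoid_inv {α : Type*} (f : Equiv.Perm α) :
    Equiv.Perm.SameCycle.setoid f⁻¹ = Equiv.Perm.SameCycle.setoid f :=
  Setoid.ext fun _ _ => Equiv.Perm.sameCycle_inv

theorem Equiv.Perm.sameCycleSetoid_mul_swap_le {α : Type*} [Finite α] [DecidableEq α]
    (f : Equiv.Perm α) (a b : α) {s : Setoid α} (h : Equiv.Perm.SameCycle.setoid f ≤ s) (hab : s a b) :
    Equiv.Perm.SameCycle.setoid (f * Equiv.swap a b) ≤ s := by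
  rw [Equiv.Perm.sameCycleSetoid_le_iff] at h ⊢
  intro x
  rw [Equiv.Perm.mul_apply]
  rcases eq_or_ne x a with rfl | hxa
  · rw [Equiv.swap_apply_left]
    exact s.trans hab (h b)
  · rcases eq_or_ne x b with rfl | hxb
    · rw [Equiv.swap_apply_right]
      exact s.trans (s.symm hab) (h a)
    · rw [Equiv.swap_apply_of_ne_of_ne hxa hxb]
      exact h x

theorem Equiv.Perm.merge_sameCycleSetoid_mul_swap {α : Type*} [Finite α] [DecidableEq α]
    (f : Equiv.Perm α) (a b : α) :
    (Equiv.Perm.SameCycle.setoid (f * Equiv.swap a b)).merge a b =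
      (Equiv.Perm.SameCycle.setoid f).merge a b := by
  have key : ∀ g : Equiv.Perm α, (Equiv.Perm.SameCycle.setoid (g * Equiv.swap a b)).merge a b ≤
      (Equiv.Perm.SameCycle.setoid g).merge a b := fun g =>
    have h := Setoid.merge_le_iff.1 (le_refl ((Equiv.Perm.SameCycle.setoid g).merge a b))
    Setoid.merge_le_iff.2 ⟨g.sameCycleSetoid_mul_swap_le a b h.1 h.2, h.2⟩
  refine le_antisymm (key f) ?_
  simpa [mul_assoc] using key (f * Equiv.swap a b)

theorem numCycles_eq_numClasses {n : ℕ} (f : Equiv.Perm (Fin n)) :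
    numCycles f = (Equiv.Perm.SameCycle.setoid f).numClasses := by
  let F : Fin n → Equiv.Perm (Fin n) ⊕ Fin n := fun x =>
    if f x = x then Sum.inr x else Sum.inl (f.cycleOf x)
  have hF : ∀ x y, F x = F y ↔ f.SameCycle x y := by
    intro x y
    by_cases hx : f x = x <;> by_cases hy : f y = y
    · simp only [F, hx, hy, if_true, Sum.inr.injEq]
      exact ⟨fun h => h ▸ Equiv.Perm.SameCycle.refl f x, fun h => h.eq_of_left hx⟩
    · simp only [F, hx, hy, if_true, if_false, reduceCtorEq, false_iff]
      exact fun h => hy (h.apply_eq_self_iff.1 hx)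
    · simp only [F, hx, hy, if_true, if_false, reduceCtorEq, false_iff]
      exact fun h => hx (h.apply_eq_self_iff.2 hy)
    · simp only [F, hx, hy, if_false, Sum.inl.injEq]
      rw [Equiv.Perm.sameCycle_iff_cycleOf_eq_of_mem_support
        (Equiv.Perm.mem_support.2 hx) (Equiv.Perm.mem_support.2 hy)]
  have himg : univ.image F = f.cycleFactorsFinset.disjSum (univ.filter fun x => f x = x) := by
    ext (c | x)
    · simp only [mem_image, mem_univ, true_and, inl_mem_disjSum]
      constructor
      · rintro ⟨x, hx⟩
        by_cases h : f x = x
        · simp [F, h] at hx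
        · simp only [F, h, if_false, Sum.inl.injEq] at hx
          rw [← hx]
          exact Equiv.Perm.cycleOf_mem_cycleFactorsFinset_iff.2 (Equiv.Perm.mem_support.2 h)
      · intro hc
        obtain ⟨x, hx⟩ := (Equiv.Perm.mem_cycleFactorsFinset_iff.1 hc).1.nonempty_support
        have hfx : f x ≠ x :=
          Equiv.Perm.mem_support.1 (Equiv.Perm.mem_cycleFactorsFinset_support_le hc hx)
        refine ⟨x, ?_⟩
        simp only [F, hfx, if_false, Sum.inl.injEq]
        exact (Equiv.Perm.cycle_is_cycleOf hx hc).symm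
    · simp only [mem_image, mem_univ, true_and, inr_mem_disjSum, mem_filter]
      constructor
      · rintro ⟨y, hy⟩
        by_cases h : f y = y
        · simp only [F, h, if_true, Sum.inr.injEq] at hy
          exact hy ▸ h
        · simp [F, h] at hy
      · intro hx
        exact ⟨x, by simp [F, hx]⟩
  have hker : Equiv.Perm.SameCycle.setoid f = Setoid.ker F :=
    Setoid.ext fun x y => (hF x y).symm
  rw [Setoid.numClasses, hker, Nat.card_congr (Setoid.quotientKerEquivRange F), numCycles,
    Equiv.Perm.cycleType_def, Multiset.card_map, ← Finset.card_def, ← card_disjSum, ← himg,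
    ← Set.ncard_coe_finset, coe_image, coe_univ, Set.image_univ]
  rfl

theorem sign_eq_neg_one_pow_numCycles {n : ℕ} (f : Equiv.Perm (Fin n)) :
    (Equiv.Perm.sign f : ℤ) = (-1) ^ (n + numCycles f) := by
  have h1 : f.support.card + (univ.filter fun x => f x = x).card = n := by
    have := Finset.card_filter_add_card_filter_not (s := (univ : Finset (Fin n)))
      (fun x => f x ≠ x)
    simpa [Equiv.Perm.support] using this
  have h2 : n + numCycles f = f.support.card + f.cycleType.card +
      2 * (univ.filter fun x => f x = x).card := by
    unfold numCycles
    omega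
  rw [Equiv.Perm.sign_of_cycleType, Equiv.Perm.sum_cycleType, h2, pow_add _ _ (2 * _), pow_mul]
  simp

theorem odd_numCycles_mul_swap_add {n : ℕ} (f : Equiv.Perm (Fin n)) {a b : Fin n} (hab : a ≠ b) :
    Odd (numCycles (f * Equiv.swap a b) + numCycles f) := by
  have h : (Equiv.Perm.sign (f * Equiv.swap a b) : ℤ) = - (Equiv.Perm.sign f : ℤ) := by
    simp [Equiv.Perm.sign_swap hab]
  rw [sign_eq_neg_one_pow_numCycles, sign_eq_neg_one_pow_numCycles] at h
  by_contra hodd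
  rw [Nat.not_odd_iff_even] at hodd
  rcases Nat.even_or_odd (n + numCycles f) with he | ho
  · have : Even (n + numCycles (f * Equiv.swap a b)) := by grind
    rw [he.neg_one_pow, this.neg_one_pow] at h
    norm_num at h
  · have : Odd (n + numCycles (f * Equiv.swap a b)) := by grind
    rw [ho.neg_one_pow, this.neg_one_pow] at h
    norm_num at h

theorem numCycles_mul_swap_of_sameCycle {n : ℕ} {f : Equiv.Perm (Fin n)} {a b : Fin n}
    (hab : a ≠ b) (h : f.SameCycle a b) :
    numCycles (f * Equiv.swap a b) = numCycles f + 1 := by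
  have hodd := odd_numCycles_mul_swap_add f hab
  have hm := f.merge_sameCycleSetoid_mul_swap a b
  rw [Setoid.merge_eq_self (r := Equiv.Perm.SameCycle.setoid f) h] at hm
  rw [numCycles_eq_numClasses, numCycles_eq_numClasses] at hodd ⊢
  by_cases h' : Equiv.Perm.SameCycle.setoid (f * Equiv.swap a b) a b
  · rw [Setoid.merge_eq_self h'] at hm
    rw [hm] at hodd
    grind
  · rw [← Setoid.numClasses_merge h', hm]

theorem numCycles_mul_swap_of_not_sameCycle {n : ℕ} {f : Equiv.Perm (Fin n)} {a b : Fin n}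
    (h : ¬ f.SameCycle a b) :
    numCycles (f * Equiv.swap a b) + 1 = numCycles f := by
  have hab : a ≠ b := fun e => h (e ▸ Equiv.Perm.SameCycle.refl f a)
  have hodd := odd_numCycles_mul_swap_add f hab
  have hm := f.merge_sameCycleSetoid_mul_swap a b
  have hc := Setoid.numClasses_merge (r := Equiv.Perm.SameCycle.setoid f) h
  rw [← hm] at hc
  rw [numCycles_eq_numClasses, numCycles_eq_numClasses] at hodd ⊢
  by_cases h' : Equiv.Perm.SameCycle.setoid (f * Equiv.swap a b) a b
  · rwa [Setoid.merge_eq_self h'] at hc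
  · rw [Setoid.numClasses_merge h'] at hc
    rw [hc] at hodd
    grind

theorem numCycles_mul_swap_le {n : ℕ} (f : Equiv.Perm (Fin n)) (a b : Fin n) :
    numCycles f ≤ numCycles (f * Equiv.swap a b) + 1 := by
  by_cases h : f.SameCycle a b
  · rcases eq_or_ne a b with rfl | hab
    · rw [Equiv.swap_self]
      exact Nat.le_succ _
    · rw [numCycles_mul_swap_of_sameCycle hab h]
      omega
  · rw [numCycles_mul_swap_of_not_sameCycle h]

theorem numCycles_le {n : ℕ} (f : Equiv.Perm (Fin n)) : numCycles f ≤ n := by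
  rw [numCycles_eq_numClasses, Setoid.numClasses]
  simpa using Nat.card_le_card_of_surjective _
    (Quotient.mk_surjective (s := Equiv.Perm.SameCycle.setoid f))

/-- The genus inequality: the genus of a triple of permutations with product one, summed over
the orbits of the group they generate, is nonnegative. -/
theorem numCycles_add_numCycles_add_numCycles_mul_le {n : ℕ} (f g : Equiv.Perm (Fin n)) :
    numCycles f + numCycles g + numCycles (f * g) ≤ n + 2 *
      (Equiv.Perm.SameCycle.setoid f ⊔ Equiv.Perm.SameCycle.setoid g).numClasses := by
  induction hk : n - numCycles g using Nat.strong_induction_on generalizing g with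
  | _ k ih =>
    subst hk
    by_cases hg : ∀ x, g x = x
    · obtain rfl : g = 1 := Equiv.ext hg
      have h : Equiv.Perm.SameCycle.setoid f ⊔ Equiv.Perm.SameCycle.setoid 1 =
          Equiv.Perm.SameCycle.setoid f :=
        sup_eq_left.2 (Equiv.Perm.sameCycleSetoid_le_iff.2 fun x =>
          (Equiv.Perm.SameCycle.setoid f).refl x)
      rw [h, mul_one, ← numCycles_eq_numClasses]
      have := numCycles_le (1 : Equiv.Perm (Fin n))
      omega
    · push Not at hg
      obtain ⟨a, ha⟩ := hg
      set b := g a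
      have hs : g.SameCycle a b :=
        Equiv.Perm.sameCycle_apply_right.2 (Equiv.Perm.SameCycle.refl g a)
      set g' := g * Equiv.swap a b with hg'
      have hgg : g = g' * Equiv.swap a b := by simp [hg', mul_assoc]
      have hc : numCycles g' = numCycles g + 1 := numCycles_mul_swap_of_sameCycle ha.symm hs
      have hle := numCycles_le g'
      have IH := ih (n - numCycles g') (by omega) g' rfl
      set R := Equiv.Perm.SameCycle.setoid f ⊔ Equiv.Perm.SameCycle.setoid g with hR
      set R' := Equiv.Perm.SameCycle.setoid f ⊔ Equiv.Perm.SameCycle.setoid g' with hR'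
      have hRab : R a b := (le_sup_right : _ ≤ R) hs
      have hmerge : R'.merge a b = R := by
        apply le_antisymm
        · refine Setoid.merge_le_iff.2 ⟨sup_le le_sup_left ?_, hRab⟩
          exact g.sameCycleSetoid_mul_swap_le a b le_sup_right hRab
        · have h := Setoid.merge_le_iff.1 (le_refl (R'.merge a b))
          refine sup_le (le_sup_left.trans h.1) ?_
          rw [hgg]
          exact g'.sameCycleSetoid_mul_swap_le a b (le_sup_right.trans h.1) h.2
      have hfg : f * g' = f * g * Equiv.swap a b := (mul_assoc _ _ _).symm
      by_cases h : R' a b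
      · rw [Setoid.merge_eq_self h] at hmerge
        rw [hmerge, hfg] at IH
        have := numCycles_mul_swap_le (f * g) a b
        omega
      · have hcard := Setoid.numClasses_merge h
        rw [hmerge] at hcard
        have hn : ¬ (f * g').SameCycle a b := by
          intro hab
          refine h ((Equiv.Perm.sameCycleSetoid_le_iff (s := R')).2 (fun x => ?_) hab)
          have h1 : R' x (g' x) := (le_sup_right : _ ≤ R')
            (Equiv.Perm.sameCycle_apply_right.2 (Equiv.Perm.SameCycle.refl g' x))
          have h2 : R' (g' x) (f (g' x)) := (le_sup_left : _ ≤ R')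
            (Equiv.Perm.sameCycle_apply_right.2 (Equiv.Perm.SameCycle.refl f (g' x)))
          exact R'.trans h1 h2
        have hm := numCycles_mul_swap_of_not_sameCycle hn
        have : f * g' * Equiv.swap a b = f * g := by rw [mul_assoc, ← hgg]
        rw [this] at hm
        omega

theorem gammaPQ_val {p q : ℕ} (x : Fin (p + q)) :
    (gammaPQ p q x).val =
      if x.val < p then (if x.val + 1 = p then 0 else x.val + 1)
      else (if x.val + 1 = p + q then p else x.val + 1) := by
  have key : ∀ (m : ℕ) (i : Fin m), (finRotate m i).val = if i.val + 1 = m then 0 else i.val + 1 := by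
    intro m i
    cases m with
    | zero => exact i.elim0
    | succ m =>
      rw [coe_finRotate]
      simp [Fin.ext_iff]
  induction x using Fin.addCases with
  | left i =>
    simp only [gammaPQ, Equiv.permCongr_apply, finSumFinEquiv_symm_apply_castAdd,
      Equiv.sumCongr_apply, Sum.map_inl, finSumFinEquiv_apply_left, Fin.val_castAdd, key]
    split_ifs <;> omega
  | right i =>
    simp only [gammaPQ, Equiv.permCongr_apply, finSumFinEquiv_symm_apply_natAdd,
      Equiv.sumCongr_apply, Sum.map_inr, finSumFinEquiv_apply_right, Fin.val_natAdd, key]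
    split_ifs <;> omega

theorem gammaPQ_sameCycle {p q : ℕ} {x y : Fin (p + q)} (h : x.val < p ↔ y.val < p) :
    (gammaPQ p q).SameCycle x y := by
  suffices H : ∀ (d : ℕ) (x y : Fin (p + q)), (x.val < p ↔ y.val < p) → y.val = x.val + d →
      (gammaPQ p q).SameCycle x y by
    rcases le_total x.val y.val with hxy | hxy
    · exact H (y.val - x.val) x y h (by omega)
    · exact (H (x.val - y.val) y x h.symm (by omega)).symm
  intro d
  induction d with
  | zero =>
    intro x y _ hd
    obtain rfl : x = y := Fin.ext hd.symm
    exact Equiv.Perm.SameCycle.refl _ _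
  | succ d ih =>
    intro x y h hd
    have hy := y.isLt
    have hv : (gammaPQ p q x).val = x.val + 1 := by
      rw [gammaPQ_val]
      split_ifs <;> omega
    exact Equiv.Perm.sameCycle_apply_left.1
      (ih (gammaPQ p q x) y (by rw [hv]; omega) (by rw [hv]; omega))

theorem odd_gammaPQ {p q : ℕ} (x : Fin (2 * p + 2 * q)) :
    Odd ((gammaPQ (2 * p) (2 * q) x).val) ↔ ¬ Odd x.val := by
  have hx := x.isLt
  have hv := gammaPQ_val x
  rw [Nat.odd_iff, Nat.odd_iff]
  split_ifs at hv <;> omega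

/-- A set of points which is a union of cycles of even length has even cardinality. -/
theorem even_card_of_evenCycles {n : ℕ} {π : Equiv.Perm (Fin n)} (h : EvenCycles π)
    (P : Fin n → Prop) (hP : ∀ x y, π.SameCycle x y → (P x ↔ P y)) :
    Even (univ.filter P).card := by
  have hc := Finset.card_eq_sum_card_image (Quotient.mk (Equiv.Perm.SameCycle.setoid π))
    (univ.filter P)
  rw [hc]
  refine Finset.even_sum _ fun c hc => ?_
  obtain ⟨x, hx, rfl⟩ := mem_image.1 hc
  suffices hset : ((univ.filter P).filter fun y =>
      Quotient.mk (Equiv.Perm.SameCycle.setoid π) y = Quotient.mk _ x) =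
      univ.filter fun y => π.SameCycle x y by
    rw [hset]
    exact h x
  ext y
  simp only [mem_filter, mem_univ, true_and] at hx ⊢
  constructor
  · rintro ⟨_, hy⟩
    exact Equiv.Perm.SameCycle.symm (Quotient.exact hy)
  · intro hy
    exact ⟨(hP x y hy).1 hx, Quotient.sound (s := Equiv.Perm.SameCycle.setoid π) hy.symm⟩

/-- If a permutation preserves `P` and changes the truth value of `Q` everywhere on `P` except
at one point, then `P` has odd cardinality. -/
theorem odd_card_of_flip {α : Type*} [Fintype α] (g : Equiv.Perm α) (P Q : α → Prop)
    (hP : ∀ x, P (g x) ↔ P x) {j : α} (hj : P j) (hQj : Q (g j) ↔ Q j)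
    (hQ : ∀ x, P x → x ≠ j → (Q (g x) ↔ ¬ Q x)) :
    Odd (univ.filter P).card := by
  have h1 : (univ.filter fun x => P x ∧ Q x).card =
      (univ.filter fun x => P x ∧ Q (g x)).card := by
    refine (Finset.card_bij (fun x _ => g x) ?_ ?_ ?_).symm
    · intro x hx
      simpa [hP] using hx
    · intro x _ y _ hxy
      exact g.injective hxy
    · intro y hy
      refine ⟨g.symm y, ?_, by simp⟩
      have := hP (g.symm y)
      simp_all
  have h2 : (univ.filter fun x => P x).card = (univ.filter fun x => P x ∧ Q x).card +
      (univ.filter fun x => P x ∧ ¬ Q x).card := by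
    rw [← Finset.filter_filter, ← Finset.filter_filter, Finset.card_filter_add_card_filter_not]
  by_cases hq : Q j
  · have h3 : (univ.filter fun x => P x ∧ Q (g x)) =
        insert j (univ.filter fun x => P x ∧ ¬ Q x) := by
      ext x
      simp only [mem_filter, mem_univ, true_and, mem_insert]
      grind
    rw [h3, card_insert_of_notMem (by simp [hq])] at h1
    rw [h2, h1]
    grind
  · have h3 : (univ.filter fun x => P x ∧ ¬ Q x) =
        insert j (univ.filter fun x => P x ∧ Q (g x)) := by
      ext x
      simp only [mem_filter, mem_univ, true_and, mem_insert]
      grind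
    rw [h3, card_insert_of_notMem (by simp [hq, hQj]), ← h1] at h2
    rw [h2]
    grind

theorem sameCycleSetoid_sup_gammaPQ_eq_top {p q : ℕ} {π : Equiv.Perm (Fin (p + q))}
    (h : ∃ i j, π.SameCycle i j ∧ ¬ (gammaPQ p q).SameCycle i j) {R : Setoid (Fin (p + q))}
    (hπ : Equiv.Perm.SameCycle.setoid π ≤ R)
    (hγ : Equiv.Perm.SameCycle.setoid (gammaPQ p q) ≤ R) : R = ⊤ := by
  obtain ⟨i, j, hij, hn⟩ := h
  have hR : R i j := hπ hij
  have hside : ¬ (i.val < p ↔ j.val < p) := fun h => hn (gammaPQ_sameCycle h)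
  have key : ∀ x, R i x := by
    intro x
    by_cases hx : i.val < p ↔ x.val < p
    · exact hγ (gammaPQ_sameCycle hx)
    · exact R.trans hR (hγ (gammaPQ_sameCycle (by tauto)))
  exact eq_top_iff.2 fun x y _ => R.trans (R.symm (key x)) (key y)

/-- In a noncrossing annular permutation with even cycles, parity changes along every step which
stays in one circle. -/
theorem IsSNC.odd_apply_iff {p q : ℕ} {π : Equiv.Perm (Fin (2 * p + 2 * q))}
    (hπ : IsSNC (2 * p) (2 * q) π) (heven : EvenCycles π) {k : Fin (2 * p + 2 * q)}
    (hk : (gammaPQ (2 * p) (2 * q)).SameCycle k (π k)) :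
    Odd (π k).val ↔ ¬ Odd k.val := by
  by_contra hpar
  have hpar : Odd (π k).val ↔ Odd k.val := by tauto
  obtain ⟨hthrough, hcount⟩ := hπ
  set γ := gammaPQ (2 * p) (2 * q) with hγdef
  have hflip : ∀ x, Odd (γ x).val ↔ ¬ Odd x.val := odd_gammaPQ
  set j := γ⁻¹ (π k) with hj
  have hγj : γ j = π k := by simp [hj]
  have hkj : k ≠ j := by
    intro e
    have := hflip k
    rw [e, hγj, ← e] at this
    tauto
  have hkjs : γ.SameCycle k j := Equiv.Perm.sameCycle_apply_right.1 (hγj.symm ▸ hk)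
  set γ' := γ * Equiv.swap k j with hγ'
  have hγ'k : γ' k = π k := by simp [hγ', hγj]
  have hγ'j : γ' j = γ k := by simp [hγ']
  have hγ'x : ∀ x, x ≠ k → x ≠ j → γ' x = γ x := by
    intro x h1 h2
    simp [hγ', Equiv.swap_apply_of_ne_of_ne h1 h2]
  have hγγ' : γ = γ' * Equiv.swap k j := by simp [hγ', mul_assoc]
  have hcγ : numCycles γ' = numCycles γ + 1 := numCycles_mul_swap_of_sameCycle hkj hkjs
  have hcγ2 : 2 ≤ numCycles γ := by
    obtain ⟨a, b, -, hab⟩ := hthrough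
    have h1 := numCycles_mul_swap_of_not_sameCycle hab
    have h2 : 0 < numCycles (γ * Equiv.swap a b) := by
      rw [numCycles_eq_numClasses]
      have : Nonempty (Quotient (Equiv.Perm.SameCycle.setoid (γ * Equiv.swap a b))) :=
        ⟨Quotient.mk _ a⟩
      exact Nat.card_pos
    omega
  have hcσ : numCycles (γ * π⁻¹) + 1 = numCycles (γ' * π⁻¹) := by
    have hfix : (γ' * π⁻¹) (π k) = π k := by simp [hγ'k]
    have hns : ¬ (γ' * π⁻¹).SameCycle (π k) (π j) := fun h =>
      hkj (π.injective (h.eq_of_left hfix))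
    rw [← numCycles_mul_swap_of_not_sameCycle hns]
    congr 2
    calc γ * π⁻¹ = γ' * Equiv.swap k j * π⁻¹ := by rw [← hγγ']
      _ = γ' * π⁻¹ * Equiv.swap (π k) (π j) := by
        rw [Equiv.swap_apply_apply]
        group
  set R := Equiv.Perm.SameCycle.setoid γ' ⊔ Equiv.Perm.SameCycle.setoid π⁻¹ with hR
  have hgenus := numCycles_add_numCycles_add_numCycles_mul_le γ' π⁻¹
  have hinv : numCycles π⁻¹ = numCycles π := by
    rw [numCycles_eq_numClasses, numCycles_eq_numClasses, Equiv.Perm.sameCycleSetoid_inv]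
  rw [← hR, hinv] at hgenus
  have hRπ : Equiv.Perm.SameCycle.setoid π ≤ R :=
    (Equiv.Perm.sameCycleSetoid_inv π).symm.le.trans le_sup_right
  have hRγ' : Equiv.Perm.SameCycle.setoid γ' ≤ R := le_sup_left
  have hRkj : R k j := by
    by_contra hn
    refine Nat.not_even_iff_odd.2 (odd_card_of_flip γ' (fun x => R x j) (fun x => Odd x.val)
      (fun x => ?_) (R.refl j) ?_ ?_) (even_card_of_evenCycles heven (fun x => R x j) ?_)
    · have := Equiv.Perm.sameCycleSetoid_le_iff.1 hRγ' x
      exact ⟨R.trans this, R.trans (R.symm this)⟩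
    · have h1 := hflip k
      have h2 := hflip j
      rw [hγj] at h2
      simp only [hγ'j]
      tauto
    · intro x hx hxj
      have hxk : x ≠ k := by
        rintro rfl
        exact hn hx
      simp only [hγ'x x hxk hxj]
      exact hflip x
    · intro x y hxy
      exact ⟨R.trans (R.symm (hRπ hxy)), R.trans (hRπ hxy)⟩
  have hRγ : Equiv.Perm.SameCycle.setoid γ ≤ R := by
    rw [hγγ']
    exact γ'.sameCycleSetoid_mul_swap_le k j hRγ' hRkj
  have htop : R = ⊤ := sameCycleSetoid_sup_gammaPQ_eq_top hthrough hRπ hRγ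
  have hone : R.numClasses ≤ 1 := by
    rw [htop, Setoid.numClasses, Finite.card_le_one_iff_subsingleton]
    exact ⟨fun a b => Quotient.inductionOn₂ a b fun _ _ => Quotient.sound trivial⟩
  omega

theorem stmt10 {p q : ℕ} (π : Equiv.Perm (Fin (2*p + 2*q)))
    (hπ : IsSNC (2*p) (2*q) π) (heven : EvenCycles π)
    (hpres : ∀ k, ¬ (gammaPQ (2*p) (2*q)).SameCycle k (π k) → SameParity k (π k))
    (hsep : Separates (gammaPQ (2*p) (2*q) * π⁻¹) (oddSet (2*p + 2*q))) :
    ∀ k : Fin (2*p + 2*q), Even (k.val + 1) →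
      (gammaPQ (2*p) (2*q)).SameCycle k (π k) → π k = gammaPQ (2*p) (2*q) k := by
  intro k hk hs
  have h1 := hπ.odd_apply_iff heven hs
  have h2 := odd_gammaPQ k
  have hko : Odd k.val := by grind
  refine hsep _ ?_ _ ?_ ?_
  · simp only [oddSet, mem_filter, mem_univ, true_and]
    grind
  · simp only [oddSet, mem_filter, mem_univ, true_and]
    grind
  · refine ⟨1, ?_⟩
    simp
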